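/- arXiv:1405.6055 — 5 statements merged into one kernel-verified Lean document; each statement's English description precedes it below -/
import Mathlib

section
/- Let A and B be real symmetric n×n matrices with B positive definite, let X be a real n×r matrix with XᵀBX = I (so X has full column rank and XᵀB²X = (BX)ᵀ(BX) is positive definite, hence invertible), and let O be a real r×r orthogonal matrix. Define λ_X = Sym((XᵀB²X)⁻¹(XᵀBAX)). Then λ_{XO} = Oᵀ λ_X O, i.e., Sym((((XO)ᵀB²(XO))⁻¹)((XO)ᵀBA(XO))) = Oᵀ Sym((XᵀB²X)⁻¹(XᵀBAX)) O. -/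
open Matrix

/-- The symmetric part of a square matrix, `Sym(D) = (D + Dᵀ)/2`. -/
noncomputable def symPart {r : ℕ} (D : Matrix (Fin r) (Fin r) ℝ) : Matrix (Fin r) (Fin r) ℝ :=
  (1 / 2 : ℝ) • (D + Dᵀ)

theorem symPart_transpose_mul_mul {r : ℕ} (O D : Matrix (Fin r) (Fin r) ℝ) :
    symPart (Oᵀ * D * O) = Oᵀ * symPart D * O := by
  simp only [symPart, transpose_mul, transpose_transpose, Matrix.mul_smul, Matrix.smul_mul,
    Matrix.mul_add, Matrix.add_mul, Matrix.mul_assoc]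

theorem inv_transpose_mul_mul_of_orthogonal {r : ℕ} {O : Matrix (Fin r) (Fin r) ℝ}
    (hO : Oᵀ * O = 1) (M : Matrix (Fin r) (Fin r) ℝ) :
    (Oᵀ * M * O)⁻¹ = Oᵀ * M⁻¹ * O := by
  rw [Matrix.mul_inv_rev, Matrix.mul_inv_rev, inv_eq_left_inv hO, inv_eq_right_inv hO,
    Matrix.mul_assoc]

/-- Equivariance of the least-squares Lagrange multiplier
`λ_X = Sym((XᵀB²X)⁻¹(XᵀBAX))` of the generalized eigenvalue problem under the
orthogonal symmetry action `X ↦ XO`: one has `λ_{XO} = Oᵀ λ_X O`. -/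
theorem lagrange_multiplier_equivariance {n r : ℕ}
    (A B : Matrix (Fin n) (Fin n) ℝ)
    (hA : A.IsSymm) (hB : B.IsSymm) (hBpd : B.PosDef)
    (X : Matrix (Fin n) (Fin r) ℝ) (hX : Xᵀ * B * X = 1)
    (O : Matrix (Fin r) (Fin r) ℝ) (hO : Oᵀ * O = 1) (hO' : O * Oᵀ = 1) :
    symPart ((((X * O)ᵀ * B * B * (X * O))⁻¹) * ((X * O)ᵀ * B * A * (X * O))) =
      Oᵀ * symPart (((Xᵀ * B * B * X)⁻¹) * (Xᵀ * B * A * X)) * O := by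
  have conj (C : Matrix (Fin n) (Fin n) ℝ) :
      (X * O)ᵀ * B * C * (X * O) = Oᵀ * (Xᵀ * B * C * X) * O := by
    simp only [transpose_mul, Matrix.mul_assoc]
  rw [conj B, conj A, inv_transpose_mul_mul_of_orthogonal hO, ← symPart_transpose_mul_mul]
  congr 1
  simp only [Matrix.mul_assoc]
  rw [← Matrix.mul_assoc O Oᵀ, hO', Matrix.one_mul]
end

section
/- Let A and B be real symmetric n×n matrices with B positive definite, let X be a real n×r matrix with XᵀBX = I, let O be a real r×r orthogonal matrix, let ξ and η be real n×r matrices, and let ω₁, ω₂ be real numbers. With λ_X = Sym((XᵀB²X)⁻¹(XᵀBAX)) and λ_{XO} = Oᵀλ_X O, the metric candidate g_X(ξ, η) = ω₁·Trace(ηᵀAξ) − ω₂·Trace(ηᵀBξ·λ_X) is invariant under the symmetry action: ω₁·Trace((ηO)ᵀA(ξO)) − ω₂·Trace((ηO)ᵀB(ξO)·λ_{XO}) = ω₁·Trace(ηᵀAξ) − ω₂·Trace(ηᵀBξ·λ_X). -/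
open Matrix

/-- Conjugation by an orthogonal matrix preserves the trace. -/
theorem trace_transpose_mul_mul_of_mul_transpose_eq_one {m R : Type*} [Fintype m] [DecidableEq m]
    [CommRing R] {O : Matrix m m R} (hO : O * Oᵀ = 1) (M : Matrix m m R) :
    (Oᵀ * M * O).trace = M.trace := by
  rw [trace_mul_cycle, hO, Matrix.one_mul]

/-- Invariance of the metric candidate
`g_X(ξ, η) = ω₁ Tr(ηᵀAξ) − ω₂ Tr(ηᵀBξ λ_X)` of the generalized eigenvalue problem
under the symmetry action `X ↦ XO`, `ξ ↦ ξO`, `η ↦ ηO`, `λ_X ↦ Oᵀ λ_X O`. -/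
theorem metric_invariance_generalized_stiefel {n r : ℕ}
    (A B : Matrix (Fin n) (Fin n) ℝ)
    (hA : A.IsSymm) (hB : B.IsSymm) (hBpd : B.PosDef)
    (X : Matrix (Fin n) (Fin r) ℝ) (hX : Xᵀ * B * X = 1)
    (O : Matrix (Fin r) (Fin r) ℝ) (hO : Oᵀ * O = 1) (hO' : O * Oᵀ = 1)
    (ξ η : Matrix (Fin n) (Fin r) ℝ) (ω₁ ω₂ : ℝ) :
    ω₁ * ((η * O)ᵀ * A * (ξ * O)).trace -
        ω₂ * ((η * O)ᵀ * B * (ξ * O) *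
          (Oᵀ * symPart (((Xᵀ * B * B * X)⁻¹) * (Xᵀ * B * A * X)) * O)).trace =
      ω₁ * (ηᵀ * A * ξ).trace -
        ω₂ * (ηᵀ * B * ξ * symPart (((Xᵀ * B * B * X)⁻¹) * (Xᵀ * B * A * X))).trace := by
  have transpose_mul_congr (C : Matrix (Fin n) (Fin n) ℝ) :
      (η * O)ᵀ * C * (ξ * O) = Oᵀ * (ηᵀ * C * ξ) * O := by
    simp only [transpose_mul, Matrix.mul_assoc]
  have conj_mul_conj (M N : Matrix (Fin r) (Fin r) ℝ) :
      Oᵀ * M * O * (Oᵀ * N * O) = Oᵀ * (M * N) * O := by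
    calc Oᵀ * M * O * (Oᵀ * N * O) = Oᵀ * M * (O * Oᵀ) * N * O := by
          simp only [Matrix.mul_assoc]
      _ = Oᵀ * (M * N) * O := by
          rw [hO', Matrix.mul_one, Matrix.mul_assoc Oᵀ M N]
  rw [transpose_mul_congr, transpose_mul_congr, conj_mul_conj,
    trace_transpose_mul_mul_of_mul_transpose_eq_one hO',
    trace_transpose_mul_mul_of_mul_transpose_eq_one hO']
end

section
/- Let A and B be real symmetric n×n matrices with B positive definite, and let X be a real n×r matrix with XᵀBX = I (so W = XᵀB²X = (BX)ᵀ(BX) is positive definite, hence invertible). Set Q = BX·W⁻²·XᵀB, K = W⁻¹(XᵀBAX), and λ* = Sym(K) = (K + Kᵀ)/2. Then for every real symmetric r×r matrix λ, Trace((AX − BXλ*)ᵀ·Q·(AX − BXλ*)) ≤ Trace((AX − BXλ)ᵀ·Q·(AX − BXλ)); that is, λ* minimizes the weighted residual ‖AX − BXλ‖_Q² over symmetric λ. -/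
open Matrix

/-- The Gram matrix of a real matrix with a left inverse is invertible. -/
theorem isUnit_det_transpose_mul_self_of_leftInverse {m n : Type*} [Fintype m] [Fintype n]
    [DecidableEq n] {Y : Matrix m n ℝ} {Z : Matrix n m ℝ} (h : Z * Y = 1) :
    IsUnit (Yᵀ * Y).det := by
  have hY : Function.Injective Y.mulVec := fun v w hvw => by
    simpa [Matrix.mulVec_mulVec, h] using congrArg (Z *ᵥ ·) hvw
  have hpd := Matrix.PosDef.conjTranspose_mul_self Y hY
  rw [Matrix.conjTranspose_eq_transpose_of_trivial] at hpd
  exact hpd.det_pos.ne'.isUnit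

/-- Symmetric and skew-symmetric matrices are orthogonal for the trace inner product. -/
theorem trace_transpose_mul_eq_zero_of_skew_of_isSymm {n : Type*} [Fintype n]
    {T D : Matrix n n ℝ} (hT : Tᵀ = -T) (hD : D.IsSymm) : (Tᵀ * D).trace = 0 := by
  have h : (Tᵀ * D).trace = (D * T).trace := by
    rw [← Matrix.trace_transpose, Matrix.transpose_mul, Matrix.transpose_transpose, hD.eq]
  have h' : (Tᵀ * D).trace = -(D * T).trace := by
    rw [hT, Matrix.neg_mul, Matrix.trace_neg, Matrix.trace_mul_comm]
  linarith

/-- The symmetric part of `K` is a closest symmetric matrix to `K` in the Frobenius norm. -/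
theorem trace_sub_symPart_le {r : ℕ} (K : Matrix (Fin r) (Fin r) ℝ)
    {S : Matrix (Fin r) (Fin r) ℝ} (hS : S.IsSymm) :
    ((K - symPart K)ᵀ * (K - symPart K)).trace ≤ ((K - S)ᵀ * (K - S)).trace := by
  have hsym : (symPart K)ᵀ = symPart K := by
    simp [symPart, add_comm]
  have hT : (K - symPart K)ᵀ = -(K - symPart K) := by
    rw [Matrix.transpose_sub, hsym]
    ext i j
    simp [symPart]
    ring
  have hD : (symPart K - S).IsSymm := by
    rw [Matrix.IsSymm, Matrix.transpose_sub, hsym, hS.eq]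
  have hcross := trace_transpose_mul_eq_zero_of_skew_of_isSymm hT hD
  have hcross' : ((symPart K - S)ᵀ * (K - symPart K)).trace = 0 := by
    rw [← Matrix.trace_transpose, Matrix.transpose_mul, Matrix.transpose_transpose, hcross]
  have hnonneg : 0 ≤ ((symPart K - S)ᵀ * (symPart K - S)).trace := by
    simpa [Matrix.conjTranspose_eq_transpose_of_trivial] using
      (Matrix.posSemidef_conjTranspose_mul_self (symPart K - S)).trace_nonneg
  rw [← sub_add_sub_cancel K (symPart K) S, Matrix.transpose_add, Matrix.add_mul,
    Matrix.mul_add, Matrix.mul_add, Matrix.trace_add, Matrix.trace_add, Matrix.trace_add,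
    hcross, hcross']
  linarith

/-- The least-squares Lagrange multiplier estimate `λ* = Sym((XᵀB²X)⁻¹(XᵀBAX))` minimizes the
weighted residual `‖AX − BXλ‖_Q² = Tr((AX − BXλ)ᵀ Q (AX − BXλ))` over symmetric `λ`, where
`Q = BX (XᵀB²X)⁻² XᵀB`. -/
theorem least_squares_multiplier_minimizes {n r : ℕ}
    (A B : Matrix (Fin n) (Fin n) ℝ) (hA : A.IsSymm) (hB : B.IsSymm) (hBpd : B.PosDef)
    (X : Matrix (Fin n) (Fin r) ℝ) (hX : Xᵀ * B * X = 1) :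
    ∀ lam : Matrix (Fin r) (Fin r) ℝ, lam.IsSymm →
      ((A * X - B * X * symPart (((Xᵀ * B * B * X)⁻¹) * (Xᵀ * B * A * X)))ᵀ *
          (B * X * ((Xᵀ * B * B * X)⁻¹ * (Xᵀ * B * B * X)⁻¹) * Xᵀ * B) *
          (A * X - B * X * symPart (((Xᵀ * B * B * X)⁻¹) * (Xᵀ * B * A * X)))).trace ≤
        ((A * X - B * X * lam)ᵀ *
          (B * X * ((Xᵀ * B * B * X)⁻¹ * (Xᵀ * B * B * X)⁻¹) * Xᵀ * B) *
          (A * X - B * X * lam)).trace := by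
  intro lam hlam
  have hW : Xᵀ * B * B * X = (B * X)ᵀ * (B * X) := by
    rw [Matrix.transpose_mul, hB.eq, Matrix.mul_assoc (Xᵀ * B)]
  have hdet : IsUnit (Xᵀ * B * B * X).det := by
    rw [hW]
    exact isUnit_det_transpose_mul_self_of_leftInverse (Z := Xᵀ) (by rw [← Matrix.mul_assoc, hX])
  have hWsymm : (Xᵀ * B * B * X)ᵀ = Xᵀ * B * B * X := by
    rw [hW, Matrix.transpose_mul, Matrix.transpose_transpose]
  have hWX : Xᵀ * (B * (B * X)) = Xᵀ * B * B * X := by simp only [Matrix.mul_assoc]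
  have hAX : Xᵀ * (B * (A * X)) = Xᵀ * B * A * X := by simp only [Matrix.mul_assoc]
  generalize Xᵀ * B * B * X = W at *
  have hM (S : Matrix (Fin r) (Fin r) ℝ) :
      W⁻¹ * Xᵀ * B * (A * X - B * X * S) = W⁻¹ * (Xᵀ * B * A * X) - S := by
    calc W⁻¹ * Xᵀ * B * (A * X - B * X * S)
        = W⁻¹ * (Xᵀ * (B * (A * X))) - W⁻¹ * (Xᵀ * (B * (B * X))) * S := by
          simp only [Matrix.mul_sub, Matrix.mul_assoc]
      _ = W⁻¹ * (Xᵀ * B * A * X) - S := by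
          rw [hAX, hWX, Matrix.nonsing_inv_mul _ hdet, Matrix.one_mul]
  have hobj (S : Matrix (Fin r) (Fin r) ℝ) :
      (A * X - B * X * S)ᵀ * (B * X * (W⁻¹ * W⁻¹) * Xᵀ * B) * (A * X - B * X * S) =
        (W⁻¹ * (Xᵀ * B * A * X) - S)ᵀ * (W⁻¹ * (Xᵀ * B * A * X) - S) := by
    rw [← hM S]
    generalize A * X - B * X * S = R
    simp only [Matrix.transpose_mul, Matrix.transpose_transpose, Matrix.transpose_nonsing_inv,
      hWsymm, hB.eq, Matrix.mul_assoc]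
  rw [hobj, hobj]
  exact trace_sub_symPart_le _ hlam
end

section
/- Let A be a real symmetric positive definite n×n matrix and let X be a real n×r matrix with XᵀX = I. Then XᵀA⁻¹X is positive definite (hence invertible), the matrix ζ* = A⁻¹X(XᵀA⁻¹X)⁻¹ − X satisfies the tangency condition ζ*ᵀX + Xᵀζ* = 0, and for every real n×r matrix ζ with ζᵀX + Xᵀζ = 0 one has Trace(ζ*ᵀAX) + ½·Trace(ζ*ᵀAζ*) ≤ Trace(ζᵀAX) + ½·Trace(ζᵀAζ), with equality if and only if ζ = ζ*. -/
open Matrix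

/-- The search direction `ζ* = A⁻¹X(XᵀA⁻¹X)⁻¹ − X` of the inverse iteration step. -/
noncomputable def invIterDir {n r : ℕ} (A : Matrix (Fin n) (Fin n) ℝ)
    (X : Matrix (Fin n) (Fin r) ℝ) : Matrix (Fin n) (Fin r) ℝ :=
  A⁻¹ * X * ((Xᵀ * A⁻¹ * X)⁻¹) - X

namespace Matrix

variable {m k : Type*} [Fintype m] [Fintype k]

/-- A skew-symmetric matrix is orthogonal to every symmetric matrix. -/
theorem trace_mul_eq_zero_of_skew_of_isSymm {K S : Matrix k k ℝ}
    (hK : K + Kᵀ = 0) (hS : S.IsSymm) : (K * S).trace = 0 := by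
  have h : (K * S).trace = (Kᵀ * S).trace := by
    rw [← trace_transpose, transpose_mul, hS.eq, trace_mul_comm]
  have h' : (K * S).trace + (Kᵀ * S).trace = 0 := by
    rw [← trace_add, ← Matrix.add_mul, hK, Matrix.zero_mul, trace_zero]
  linarith

theorem PosDef.trace_transpose_mul_mul_nonneg {A : Matrix m m ℝ} (hA : A.PosDef)
    (D : Matrix m k ℝ) : 0 ≤ (Dᵀ * A * D).trace := by
  rw [← conjTranspose_eq_transpose_of_trivial]
  exact (hA.posSemidef.conjTranspose_mul_mul_same D).trace_nonneg

theorem PosDef.trace_transpose_mul_mul_eq_zero_iff {A : Matrix m m ℝ} (hA : A.PosDef)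
    {D : Matrix m k ℝ} : (Dᵀ * A * D).trace = 0 ↔ D = 0 := by
  refine ⟨fun h => ?_, fun h => by simp [h]⟩
  have hdiag : ∀ j, (Dᵀ * A * D) j j = star (D.col j) ⬝ᵥ (A *ᵥ D.col j) := fun j => by
    rw [Matrix.mul_assoc, star_trivial]
    rfl
  have hnonneg : ∀ j ∈ Finset.univ, 0 ≤ (Dᵀ * A * D) j j := fun j _ => by
    rw [hdiag]
    exact hA.posSemidef.dotProduct_mulVec_nonneg _
  have hzero := (Finset.sum_eq_zero_iff_of_nonneg hnonneg).mp h
  refine ext_col fun j => ?_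
  by_contra hj
  have hpos := hA.dotProduct_mulVec_pos (x := D.col j) hj
  rw [← hdiag, hzero j (Finset.mem_univ j)] at hpos
  exact lt_irrefl _ hpos

/-- Second-order expansion of `ζ ↦ Tr(ζᵀAX) + ½ Tr(ζᵀAζ)` around `Z`. -/
theorem IsSymm.trace_quadratic_expansion {A : Matrix m m ℝ} (hA : A.IsSymm)
    (X Z ζ : Matrix m k ℝ) :
    (ζᵀ * A * X).trace + (1 / 2 : ℝ) * (ζᵀ * A * ζ).trace =
      (Zᵀ * A * X).trace + (1 / 2 : ℝ) * (Zᵀ * A * Z).trace +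
        ((ζ - Z)ᵀ * (A * (X + Z))).trace +
        (1 / 2 : ℝ) * ((ζ - Z)ᵀ * A * (ζ - Z)).trace := by
  have h : (Zᵀ * (A * ζ)).trace = (ζᵀ * (A * Z)).trace := by
    rw [← trace_transpose]
    simp [hA.eq, Matrix.mul_assoc]
  simp only [transpose_sub, Matrix.mul_assoc, Matrix.sub_mul, Matrix.mul_sub, Matrix.mul_add,
    trace_sub, trace_add, h]
  ring

end Matrix

/-- For `A` symmetric positive definite and `XᵀX = I`, the matrix `XᵀA⁻¹X` is positive
definite, the direction `ζ* = A⁻¹X(XᵀA⁻¹X)⁻¹ − X` is tangent (`ζ*ᵀX + Xᵀζ* = 0`), and `ζ*`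
is the unique minimizer of `Tr(ζᵀAX) + ½ Tr(ζᵀAζ)` over the tangent space
`{ζ : ζᵀX + Xᵀζ = 0}`. -/
theorem inverse_iteration_is_riemannian_gradient {n r : ℕ}
    (A : Matrix (Fin n) (Fin n) ℝ) (hA : A.IsSymm) (hApd : A.PosDef)
    (X : Matrix (Fin n) (Fin r) ℝ) (hX : Xᵀ * X = 1) :
    (Xᵀ * A⁻¹ * X).PosDef ∧
    ((invIterDir A X)ᵀ * X + Xᵀ * invIterDir A X = 0) ∧
    (∀ ζ : Matrix (Fin n) (Fin r) ℝ, ζᵀ * X + Xᵀ * ζ = 0 →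
      (((invIterDir A X)ᵀ * A * X).trace +
          (1 / 2 : ℝ) * ((invIterDir A X)ᵀ * A * invIterDir A X).trace ≤
        (ζᵀ * A * X).trace + (1 / 2 : ℝ) * (ζᵀ * A * ζ).trace) ∧
      (((invIterDir A X)ᵀ * A * X).trace +
          (1 / 2 : ℝ) * ((invIterDir A X)ᵀ * A * invIterDir A X).trace =
        (ζᵀ * A * X).trace + (1 / 2 : ℝ) * (ζᵀ * A * ζ).trace ↔ ζ = invIterDir A X)) := by
  have hM : (Xᵀ * A⁻¹ * X).PosDef := by
    have hinj : Function.Injective X.mulVec :=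
      Function.LeftInverse.injective (g := Xᵀ.mulVec) fun v => by simp [hX]
    rw [← conjTranspose_eq_transpose_of_trivial]
    exact hApd.inv.conjTranspose_mul_mul_same hinj
  have hMdet : IsUnit (Xᵀ * A⁻¹ * X).det := (isUnit_iff_isUnit_det _).mp hM.isUnit
  have hAdet : IsUnit A.det := (isUnit_iff_isUnit_det _).mp hApd.isUnit
  have hSsymm : ((Xᵀ * A⁻¹ * X)⁻¹).IsSymm := by
    have := hM.inv.isHermitian.eq
    rwa [conjTranspose_eq_transpose_of_trivial] at this
  have hXZ : Xᵀ * invIterDir A X = 0 := by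
    rw [invIterDir, Matrix.mul_sub, hX, ← Matrix.mul_assoc, ← Matrix.mul_assoc,
      mul_nonsing_inv _ hMdet, sub_self]
  have hZX : (invIterDir A X)ᵀ * X = 0 := by
    simpa using congrArg transpose hXZ
  have hgrad : A * (X + invIterDir A X) = X * (Xᵀ * A⁻¹ * X)⁻¹ := by
    rw [invIterDir, add_sub_cancel, Matrix.mul_assoc A⁻¹, mul_nonsing_inv_cancel_left _ _ hAdet]
  refine ⟨hM, by rw [hXZ, hZX, add_zero], fun ζ hζ => ?_⟩
  have hlin : ((ζ - invIterDir A X)ᵀ * (A * (X + invIterDir A X))).trace = 0 := by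
    rw [hgrad, ← Matrix.mul_assoc]
    refine trace_mul_eq_zero_of_skew_of_isSymm ?_ hSsymm
    rw [transpose_mul, transpose_transpose, transpose_sub, Matrix.sub_mul, Matrix.mul_sub,
      hXZ, hZX, sub_zero, sub_zero, hζ]
  have hexp := hA.trace_quadratic_expansion X (invIterDir A X) ζ
  have hnonneg := hApd.trace_transpose_mul_mul_nonneg (ζ - invIterDir A X)
  refine ⟨by linarith, ?_⟩
  rw [← sub_eq_zero (a := ζ), ← hApd.trace_transpose_mul_mul_eq_zero_iff]
  constructor <;> intro h <;> linarith
end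

section
/- Let A be a real symmetric n×n matrix, λ a real symmetric r×r matrix, ω a real number, and X a real n×r matrix with XᵀX = I. Define φ(ζ) = Trace(ζᵀAX) + ½·(Trace(ζᵀAζ) − ω·Trace(ζᵀζλ)) and the tangent set T = {ζ ∈ ℝ^{n×r} : ζᵀX + Xᵀζ = 0}. Suppose ζ* ∈ T, suppose there exists a real symmetric r×r matrix μ such that Aζ* − ωζ*λ = Xμ − AX, and suppose Trace(ηᵀAη) − ω·Trace(ηᵀηλ) ≥ 0 for all η ∈ T. Then φ(ζ*) ≤ φ(ζ) for all ζ ∈ T. -/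
open Matrix

/-- The trace of a skew-symmetric matrix times a symmetric matrix vanishes. -/
theorem trace_mul_eq_zero_of_transpose_eq_neg_of_isSymm {m : Type*} [Fintype m]
    {S M : Matrix m m ℝ} (hS : Sᵀ = -S) (hM : M.IsSymm) : (S * M).trace = 0 := by
  have h : (S * M).trace = -(S * M).trace := by
    conv_lhs => rw [← trace_transpose, transpose_mul, hS, hM.eq, trace_mul_comm, neg_mul, trace_neg]
  linarith

/-- The bilinear form `(ξ, ζ) ↦ Tr(ξᵀAζ)` is symmetric when `A` is. -/
theorem trace_transpose_mul_mul_comm {m k : Type*} [Fintype m] [Fintype k]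
    {A : Matrix m m ℝ} (hA : A.IsSymm) (ξ ζ : Matrix m k ℝ) :
    (ξᵀ * A * ζ).trace = (ζᵀ * A * ξ).trace := by
  rw [← trace_transpose]
  simp only [transpose_mul, transpose_transpose, hA.eq, Matrix.mul_assoc]

/-- The bilinear form `(ξ, ζ) ↦ Tr(ξᵀζL)` is symmetric when `L` is. -/
theorem trace_transpose_mul_mul_right_comm {m k : Type*} [Fintype m] [Fintype k]
    {L : Matrix k k ℝ} (hL : L.IsSymm) (ξ ζ : Matrix m k ℝ) :
    (ξᵀ * ζ * L).trace = (ζᵀ * ξ * L).trace := by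
  rw [← trace_transpose]
  simp only [transpose_mul, transpose_transpose, hL.eq]
  rw [trace_mul_comm]

/-- Sufficiency of the first-order system for the GRQI search-direction subproblem: if
`ζ*` is tangent, satisfies `Aζ* − ωζ*λ = Xμ − AX` for some symmetric `μ`, and the quadratic
form `η ↦ Tr(ηᵀAη) − ω Tr(ηᵀηλ)` is nonnegative on the tangent space, then `ζ*` minimizes
`φ(ζ) = Tr(ζᵀAX) + ½(Tr(ζᵀAζ) − ω Tr(ζᵀζλ))` over the tangent space. -/
theorem grqi_first_order_system_sufficient {n r : ℕ}
    (A : Matrix (Fin n) (Fin n) ℝ) (hA : A.IsSymm)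
    (lam : Matrix (Fin r) (Fin r) ℝ) (hlam : lam.IsSymm)
    (ω : ℝ)
    (X : Matrix (Fin n) (Fin r) ℝ) (hX : Xᵀ * X = 1)
    (ζs : Matrix (Fin n) (Fin r) ℝ)
    (hζs : ζsᵀ * X + Xᵀ * ζs = 0)
    (hsys : ∃ μ : Matrix (Fin r) (Fin r) ℝ, μ.IsSymm ∧
      A * ζs - ω • (ζs * lam) = X * μ - A * X)
    (hnn : ∀ η : Matrix (Fin n) (Fin r) ℝ, ηᵀ * X + Xᵀ * η = 0 →
      0 ≤ (ηᵀ * A * η).trace - ω * (ηᵀ * η * lam).trace) :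
    ∀ ζ : Matrix (Fin n) (Fin r) ℝ, ζᵀ * X + Xᵀ * ζ = 0 →
      (ζsᵀ * A * X).trace +
          (1 / 2 : ℝ) * ((ζsᵀ * A * ζs).trace - ω * (ζsᵀ * ζs * lam).trace) ≤
        (ζᵀ * A * X).trace +
          (1 / 2 : ℝ) * ((ζᵀ * A * ζ).trace - ω * (ζᵀ * ζ * lam).trace) := by
  obtain ⟨μ, hμ, hsys⟩ := hsys
  intro ζ hζ
  obtain ⟨η, rfl⟩ : ∃ η, ζ = ζs + η := ⟨ζ - ζs, by abel⟩
  have hη : ηᵀ * X + Xᵀ * η = 0 := by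
    rw [transpose_add, Matrix.add_mul, Matrix.mul_add, add_add_add_comm, hζs, zero_add] at hζ
    exact hζ
  have hskew : (ηᵀ * X)ᵀ = -(ηᵀ * X) := by
    rw [transpose_mul, transpose_transpose]
    exact eq_neg_of_add_eq_zero_right hη
  have hmult := trace_mul_eq_zero_of_transpose_eq_neg_of_isSymm hskew hμ
  have hstat : (ηᵀ * A * ζs).trace - ω * (ηᵀ * ζs * lam).trace = -(ηᵀ * A * X).trace := by
    have h := congrArg (fun M => (ηᵀ * M).trace) hsys
    simp only [Matrix.mul_sub, Matrix.mul_smul, trace_sub, trace_smul, smul_eq_mul,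
      ← Matrix.mul_assoc] at h
    linarith
  have hcommA := trace_transpose_mul_mul_comm hA ζs η
  have hcommL := trace_transpose_mul_mul_right_comm hlam ζs η
  have hnonneg := hnn η hη
  simp only [transpose_add, Matrix.add_mul, Matrix.mul_add, trace_add]
  rw [hcommA, hcommL]
  linarith
end
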